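/- arXiv:2103.15373 — 9 statements merged into one kernel-verified Lean document; each statement's English description precedes it below -/
import Mathlib

section
/- Let c₁, c₂ ∈ ℂ and write c₁ = |c| cos(α) e^{iβ}, c₂ = |c| sin(α) e^{iγ} for real numbers |c| ≥ 0, α, β, γ. Then Q_c = Q_H Q_d Q_H†, where Q_H is the 3×3 complex matrix with rows (1, 0, 0), (0, cos(α) e^{iβ}, −sin(α) e^{iβ}), (0, sin(α) e^{iγ}, cos(α) e^{iγ}), Q_d is the 3×3 matrix with rows (1, −|c|, 0), (|c|, 1, 0), (0, 0, 1), and † denotes the conjugate transpose. -/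
open ComplexConjugate Matrix

theorem exp_I_mul_mul_conj (x : ℝ) :
    Complex.exp (Complex.I * x) * conj (Complex.exp (Complex.I * x)) = 1 := by
  rw [← Complex.exp_conj, ← Complex.exp_add]
  simp

theorem stmt0 (m α β γ : ℝ) (hm : 0 ≤ m) (c₁ c₂ : ℂ)
    (hc₁ : c₁ = (m * Real.cos α : ℝ) * Complex.exp (Complex.I * β))
    (hc₂ : c₂ = (m * Real.sin α : ℝ) * Complex.exp (Complex.I * γ)) :
    (!![1, -conj c₁, -conj c₂; c₁, 1, 0; c₂, 0, 1] : Matrix (Fin 3) (Fin 3) ℂ) =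
      (!![1, 0, 0;
          0, (Real.cos α : ℂ) * Complex.exp (Complex.I * β),
            -(Real.sin α : ℂ) * Complex.exp (Complex.I * β);
          0, (Real.sin α : ℂ) * Complex.exp (Complex.I * γ),
            (Real.cos α : ℂ) * Complex.exp (Complex.I * γ)] : Matrix (Fin 3) (Fin 3) ℂ)
      * (!![1, -(m : ℂ), 0; (m : ℂ), 1, 0; 0, 0, 1] : Matrix (Fin 3) (Fin 3) ℂ)
      * (!![1, 0, 0;
          0, (Real.cos α : ℂ) * Complex.exp (Complex.I * β),
            -(Real.sin α : ℂ) * Complex.exp (Complex.I * β);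
          0, (Real.sin α : ℂ) * Complex.exp (Complex.I * γ),
            (Real.cos α : ℂ) * Complex.exp (Complex.I * γ)] : Matrix (Fin 3) (Fin 3) ℂ)ᴴ := by
  have hu := exp_I_mul_mul_conj β
  have hv := exp_I_mul_mul_conj γ
  have hcs : (Real.cos α : ℂ) ^ 2 + (Real.sin α : ℂ) ^ 2 = 1 := by
    exact_mod_cast Real.cos_sq_add_sin_sq α
  subst hc₁ hc₂
  generalize Complex.exp (Complex.I * β) = u at *
  generalize Complex.exp (Complex.I * γ) = v at *
  generalize Real.cos α = c at *
  generalize Real.sin α = s at *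
  ext i j
  fin_cases i <;> fin_cases j <;>
    simp [Matrix.mul_apply, Fin.sum_univ_three, Matrix.conjTranspose_apply] <;>
    grind
end

section
/- Let λ₁, λ ∈ ℂ with λ ≠ conj(λ₁), let c₁, c₂ ∈ ℂ, let N be a natural number, and set r = (λ − λ₁)/(λ − conj(λ₁)). Then Q_c is invertible with det(Q_c) = 1 + |c₁|² + |c₂|², and I₃ + ((r^N − 1)/(1 + |c₁|² + |c₂|²)) · c c† = Q_c · diag(r^N, 1, 1) · Q_c⁻¹, where c = (1, c₁, c₂)ᵀ is a column vector, c† its conjugate transpose (so c c† is a 3×3 matrix), and I₃ is the 3×3 identity matrix. -/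
open ComplexConjugate Matrix

theorem stmt1 (lam lam₁ c₁ c₂ : ℂ) (h : lam ≠ conj lam₁) (N : ℕ) :
    let r : ℂ := (lam - lam₁) / (lam - conj lam₁)
    let Qc : Matrix (Fin 3) (Fin 3) ℂ := !![1, -conj c₁, -conj c₂; c₁, 1, 0; c₂, 0, 1]
    let c : Fin 3 → ℂ := ![1, c₁, c₂]
    IsUnit Qc ∧
    Qc.det = 1 + (Complex.normSq c₁ : ℂ) + (Complex.normSq c₂ : ℂ) ∧
    (1 : Matrix (Fin 3) (Fin 3) ℂ) +
        ((r ^ N - 1) / (1 + (Complex.normSq c₁ : ℂ) + (Complex.normSq c₂ : ℂ))) •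
          Matrix.vecMulVec c (fun i => conj (c i)) =
      Qc * Matrix.diagonal ![r ^ N, 1, 1] * Qc⁻¹ := by
  intro r Qc c
  have hD : 1 + (Complex.normSq c₁ : ℂ) + (Complex.normSq c₂ : ℂ) ≠ 0 := by
    have hpos : 0 < 1 + Complex.normSq c₁ + Complex.normSq c₂ := by
      linarith [Complex.normSq_nonneg c₁, Complex.normSq_nonneg c₂]
    exact_mod_cast hpos.ne'
  have hdet : Qc.det = 1 + (Complex.normSq c₁ : ℂ) + (Complex.normSq c₂ : ℂ) := by
    simp [Qc, Matrix.det_fin_three, ← Complex.mul_conj]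
    ring
  have hunit : IsUnit Qc.det := hdet ▸ hD.isUnit
  refine ⟨(Matrix.isUnit_iff_isUnit_det Qc).2 hunit, hdet, ?_⟩
  generalize r ^ N = a
  have key : ((1 : Matrix (Fin 3) (Fin 3) ℂ) +
        ((a - 1) / (1 + (Complex.normSq c₁ : ℂ) + (Complex.normSq c₂ : ℂ))) •
          Matrix.vecMulVec c (fun i => conj (c i))) * Qc =
      Qc * Matrix.diagonal ![a, 1, 1] := by
    rw [← Complex.mul_conj, ← Complex.mul_conj] at hD ⊢
    ext i j
    rw [Matrix.mul_diagonal, Matrix.mul_apply, Fin.sum_univ_three]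
    simp only [Matrix.add_apply, Matrix.smul_apply, Matrix.vecMulVec_apply, Matrix.one_apply]
    fin_cases i <;> fin_cases j <;> simp [Qc, c] <;>
      field_simp <;> ring
  rw [← key, Matrix.mul_nonsing_inv_cancel_right _ _ hunit]
end

section
/- Fix t ∈ ℝ, λ₁ ∈ ℂ with Im(λ₁) > 0, c₁, c₂ ∈ ℂ, and λ ∈ ℂ with λ ≠ conj(λ₁). For x ∈ ℝ let Φ₁(x) = (e^{−iλ₁(x+λ₁t)}, c₁ e^{iλ₁(x+λ₁t)}, c₂ e^{iλ₁(x+λ₁t)}) ∈ ℂ³ and let T^{[1]}(λ; x) = I₃ − ((λ₁ − conj(λ₁))/(λ − conj(λ₁))) · Φ₁(x)Φ₁(x)†/(Φ₁(x)†Φ₁(x)). Then, as x → +∞, every entry of the matrix T^{[1]}(λ; x) − diag((λ−λ₁)/(λ−conj(λ₁)), 1, 1) is O(e^{−2 Im(λ₁) x}). -/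
open ComplexConjugate Matrix Asymptotics

open Filter

/-- The exponential `exp (i μ (x + μ t))` has modulus `exp (-Im μ x) * exp (-Im (μ²) t)`. -/
lemma norm_exp_I_mul_phase (μ : ℂ) (t x : ℝ) :
    ‖Complex.exp (Complex.I * μ * ((x : ℂ) + μ * (t : ℂ)))‖ =
      Real.exp (-μ.im * x) * Real.exp (-(2 * μ.re * μ.im * t)) := by
  rw [Complex.norm_exp, ← Real.exp_add]
  congr 1
  simp
  ring

lemma exp_I_mul_phase_isBigO_one {μ : ℂ} (hμ : 0 < μ.im) (t : ℝ) :
    (fun x : ℝ => Complex.exp (Complex.I * μ * ((x : ℂ) + μ * (t : ℂ)))) =O[atTop]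
      fun _ : ℝ => (1 : ℝ) := by
  refine IsBigO.of_bound (Real.exp (-(2 * μ.re * μ.im * t))) ?_
  filter_upwards [eventually_ge_atTop 0] with x hx
  rw [norm_exp_I_mul_phase, norm_one, mul_one]
  refine mul_le_of_le_one_left (Real.exp_pos _).le (Real.exp_le_one_iff.2 ?_)
  nlinarith

/-- A real quantity bounded below by `|w|⁻²`, with `w` the decaying exponential, has inverse
`O(exp (-2 Im μ x))`. -/
lemma inv_isBigO_exp_of_normSq_le (μ : ℂ) (t : ℝ) (s : ℝ → ℝ)
    (hs : ∀ x : ℝ, Complex.normSq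
      (Complex.exp (-Complex.I * μ * ((x : ℂ) + μ * (t : ℂ)))) ≤ s x) :
    (fun x : ℝ => ((s x : ℂ))⁻¹) =O[atTop] fun x : ℝ => Real.exp (-2 * μ.im * x) := by
  refine IsBigO.of_bound (Real.exp (-(2 * μ.re * μ.im * t)) ^ 2) (Eventually.of_forall fun x => ?_)
  have hw : Complex.normSq (Complex.exp (-Complex.I * μ * ((x : ℂ) + μ * (t : ℂ)))) =
      (Real.exp (-(2 * μ.re * μ.im * t)) ^ 2 * Real.exp (-2 * μ.im * x))⁻¹ := by
    rw [neg_mul, neg_mul, Complex.exp_neg, map_inv₀, Complex.normSq_eq_norm_sq,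
      norm_exp_I_mul_phase, mul_pow, ← Real.exp_nat_mul (-μ.im * x), mul_comm,
      show ((2 : ℕ) : ℝ) * (-μ.im * x) = -2 * μ.im * x by push_cast; ring]
  have hpos : 0 < Real.exp (-(2 * μ.re * μ.im * t)) ^ 2 * Real.exp (-2 * μ.im * x) := by
    positivity
  have hle := hs x
  rw [hw] at hle
  have hsx : 0 < s x := (inv_pos.2 hpos).trans_le hle
  rw [norm_inv, Complex.norm_real, Real.norm_of_nonneg hsx.le, Real.norm_of_nonneg
    (Real.exp_pos _).le]
  exact inv_le_of_inv_le₀ hpos hle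

theorem stmt9 (t : ℝ) (lam₁ : ℂ) (him : 0 < lam₁.im) (c₁ c₂ : ℂ) (lam : ℂ)
    (h : lam ≠ conj lam₁) :
    let Φ : ℝ → Fin 3 → ℂ := fun x =>
      ![Complex.exp (-Complex.I * lam₁ * ((x : ℂ) + lam₁ * (t : ℂ))),
        c₁ * Complex.exp (Complex.I * lam₁ * ((x : ℂ) + lam₁ * (t : ℂ))),
        c₂ * Complex.exp (Complex.I * lam₁ * ((x : ℂ) + lam₁ * (t : ℂ)))]
    let S : ℝ → ℂ := fun x =>
      ((Complex.normSq (Φ x 0) + Complex.normSq (Φ x 1) + Complex.normSq (Φ x 2) : ℝ) : ℂ)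
    let T : ℝ → Matrix (Fin 3) (Fin 3) ℂ := fun x =>
      1 - ((lam₁ - conj lam₁) / ((lam - conj lam₁) * S x)) •
        Matrix.vecMulVec (Φ x) (fun i => conj (Φ x i))
    ∀ i j : Fin 3,
      (fun x : ℝ =>
          (T x - Matrix.diagonal ![(lam - lam₁) / (lam - conj lam₁), 1, 1]) i j)
        =O[Filter.atTop] fun x : ℝ => Real.exp (-2 * lam₁.im * x) := by
  intro Φ S T i j
  have hd : lam - conj lam₁ ≠ 0 := sub_ne_zero.2 h
  have hS : ∀ x, S x ≠ 0 := fun x => by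
    refine Complex.ofReal_ne_zero.2 (ne_of_gt ?_)
    have h0 : 0 < Complex.normSq (Φ x 0) := Complex.normSq_pos.2 (Complex.exp_ne_zero _)
    have h1 := Complex.normSq_nonneg (Φ x 1)
    have h2 := Complex.normSq_nonneg (Φ x 2)
    linarith
  have hSinv : (fun x => (S x)⁻¹) =O[atTop] fun x : ℝ => Real.exp (-2 * lam₁.im * x) := by
    refine inv_isBigO_exp_of_normSq_le lam₁ t _ fun x => ?_
    have h1 := Complex.normSq_nonneg (Φ x 1)
    have h2 := Complex.normSq_nonneg (Φ x 2)
    change Complex.normSq (Φ x 0) ≤ _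
    linarith
  have of_numerator : ∀ (f n : ℝ → ℂ), n =O[atTop] (fun _ : ℝ => (1 : ℝ)) →
      (∀ x, f x = (lam₁ - conj lam₁) / (lam - conj lam₁) * n x * (S x)⁻¹) →
      f =O[atTop] fun x : ℝ => Real.exp (-2 * lam₁.im * x) := fun f n hn hf => by
    rw [funext hf]
    simpa using (hn.const_mul_left _).mul hSinv
  have hw := exp_I_mul_phase_isBigO_one him t
  have hw1 : (fun x => Φ x 1) =O[atTop] fun _ : ℝ => (1 : ℝ) := hw.const_mul_left c₁
  have hw2 : (fun x => Φ x 2) =O[atTop] fun _ : ℝ => (1 : ℝ) := hw.const_mul_left c₂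
  have conj_isBigO : ∀ {f : ℝ → ℂ}, f =O[atTop] (fun _ : ℝ => (1 : ℝ)) →
      (fun x => conj (f x)) =O[atTop] fun _ : ℝ => (1 : ℝ) := fun hf =>
    IsBigO.of_norm_left (by simpa using hf.norm_left)
  have mul_isBigO : ∀ {f g : ℝ → ℂ}, f =O[atTop] (fun _ : ℝ => (1 : ℝ)) →
      g =O[atTop] (fun _ : ℝ => (1 : ℝ)) →
      (fun x => f x * g x) =O[atTop] fun _ : ℝ => (1 : ℝ) := fun hf hg => by
    simpa using hf.mul hg
  have h01 : ∀ x, Φ x 0 * Complex.exp (Complex.I * lam₁ * ((x : ℂ) + lam₁ * (t : ℂ))) = 1 :=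
    fun x => by
      change Complex.exp _ * Complex.exp _ = 1
      rw [← Complex.exp_add, neg_mul, neg_mul, neg_add_cancel, Complex.exp_zero]
  have bounded_zero_mul : ∀ (c : ℂ) (u : ℝ → ℂ),
      (∀ x, u x = c * Complex.exp (Complex.I * lam₁ * ((x : ℂ) + lam₁ * (t : ℂ)))) →
      (fun x => Φ x 0 * conj (u x)) =O[atTop] fun _ : ℝ => (1 : ℝ) := fun c u hu => by
    refine IsBigO.of_bound ‖c‖ (Eventually.of_forall fun x => le_of_eq ?_)
    rw [norm_mul, RCLike.norm_conj, ← norm_mul, hu, mul_left_comm, h01]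
    simp
  have h0_1 := bounded_zero_mul c₁ (fun x => Φ x 1) fun _ => rfl
  have h0_2 := bounded_zero_mul c₂ (fun x => Φ x 2) fun _ => rfl
  have swap : ∀ {f g : ℝ → ℂ}, (fun x => f x * conj (g x)) =O[atTop] (fun _ : ℝ => (1 : ℝ)) →
      (fun x => g x * conj (f x)) =O[atTop] fun _ : ℝ => (1 : ℝ) := fun hfg => by
    simpa [mul_comm] using conj_isBigO hfg
  have off_corner : ∀ k l : Fin 3, ¬(k = 0 ∧ l = 0) →
      (fun x => Φ x k * conj (Φ x l)) =O[atTop] fun _ : ℝ => (1 : ℝ) := by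
    intro k l hkl
    fin_cases k <;> fin_cases l
    · exact absurd ⟨rfl, rfl⟩ hkl
    · exact h0_1
    · exact h0_2
    · exact swap h0_1
    · exact mul_isBigO hw1 (conj_isBigO hw1)
    · exact mul_isBigO hw1 (conj_isBigO hw2)
    · exact swap h0_2
    · exact mul_isBigO hw2 (conj_isBigO hw1)
    · exact mul_isBigO hw2 (conj_isBigO hw2)
  by_cases hij : i = 0 ∧ j = 0
  · obtain ⟨rfl, rfl⟩ := hij
    refine of_numerator _ _
      ((off_corner 1 1 (by decide)).add (off_corner 2 2 (by decide))) fun x => ?_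
    have hSx : S x = Φ x 0 * conj (Φ x 0) + Φ x 1 * conj (Φ x 1) + Φ x 2 * conj (Φ x 2) := by
      simp only [Complex.mul_conj, S, Complex.ofReal_add]
    have hne := hS x
    simp only [T, Matrix.sub_apply, Matrix.smul_apply, Matrix.vecMulVec_apply, smul_eq_mul,
      Matrix.one_apply_eq, Matrix.diagonal_apply_eq, Matrix.cons_val_zero]
    have hcorner : Φ x 1 * conj (Φ x 1) + Φ x 2 * conj (Φ x 2) =
        S x - Φ x 0 * conj (Φ x 0) := by
      rw [hSx]; ring
    rw [hcorner]
    field_simp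
    ring
  · refine of_numerator _ _ (off_corner i j hij).neg_left fun x => ?_
    have hdiag : (1 : Matrix (Fin 3) (Fin 3) ℂ) i j =
        Matrix.diagonal ![(lam - lam₁) / (lam - conj lam₁), 1, 1] i j := by
      fin_cases i <;> fin_cases j <;> simp_all
    have hne := hS x
    simp only [T, Matrix.sub_apply, Matrix.smul_apply, Matrix.vecMulVec_apply, smul_eq_mul, hdiag]
    field_simp
    ring
end

section
/- Fix t ∈ ℝ, λ₁ ∈ ℂ with Im(λ₁) > 0, c₁ ∈ ℂ with c₁ ≠ 0, and λ ∈ ℂ with λ ≠ conj(λ₁); set r = (λ−λ₁)/(λ−conj(λ₁)). For x ∈ ℝ let Φ₁(x) = (e^{−iλ₁(x+λ₁t)}, c₁ e^{iλ₁(x+λ₁t)}, c₁ e^{iλ₁(x+λ₁t)}) ∈ ℂ³ and let T^{[1]}(λ; x) = I₃ − ((λ₁ − conj(λ₁))/(λ − conj(λ₁))) · Φ₁(x)Φ₁(x)†/(Φ₁(x)†Φ₁(x)). Then, as x → −∞, every entry of the matrix T^{[1]}(λ; x) − A(λ) is O(e^{2 Im(λ₁) x}), where A(λ) is the 3×3 matrix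 with rows (1, 0, 0), (0, 1/2 + r/2, −1/2 + r/2), (0, −1/2 + r/2, 1/2 + r/2). -/
open ComplexConjugate Matrix Asymptotics

/-- The orthogonal projection onto the line spanned by `(p, q, q)` is within `‖p‖ / ‖q‖`, entrywise,
of the orthogonal projection onto the line spanned by `(0, 1, 1)`. -/
lemma norm_projection_sub_le (p q : ℂ) (hq : q ≠ 0) (i j : Fin 3) :
    ‖(((Complex.normSq p + Complex.normSq q + Complex.normSq q : ℝ) : ℂ)⁻¹ •
        Matrix.vecMulVec ![p, q, q] (fun i => conj (![p, q, q] i)) -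
      (!![0, 0, 0; 0, 1 / 2, 1 / 2; 0, 1 / 2, 1 / 2] : Matrix (Fin 3) (Fin 3) ℂ)) i j‖ ≤ ‖p‖ / ‖q‖ := by
  have hq' : 0 < ‖q‖ := norm_pos_iff.mpr hq
  set s : ℝ := Complex.normSq p + Complex.normSq q + Complex.normSq q with hs
  have hs' : s = ‖p‖ ^ 2 + 2 * ‖q‖ ^ 2 := by
    rw [hs, Complex.normSq_eq_norm_sq, Complex.normSq_eq_norm_sq]; ring
  have hspos : 0 < s := by rw [hs']; positivity
  have hsC : (s : ℂ) ≠ 0 := by exact_mod_cast hspos.ne'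
  have hpp : s⁻¹ * (‖p‖ * ‖p‖) ≤ ‖p‖ / ‖q‖ := by
    rw [inv_mul_eq_div, div_le_div_iff₀ hspos hq', hs', mul_assoc]
    gcongr
    nlinarith [sq_nonneg (‖p‖ - ‖q‖)]
  have hpq : s⁻¹ * (‖p‖ * ‖q‖) ≤ ‖p‖ / ‖q‖ := by
    rw [inv_mul_eq_div, div_le_div_iff₀ hspos hq', hs', mul_assoc]
    gcongr
    nlinarith [sq_nonneg ‖p‖, sq_nonneg ‖q‖]
  have hqq : ‖(s : ℂ)⁻¹ * (q * conj q) - 1 / 2‖ ≤ ‖p‖ / ‖q‖ := by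
    have : (s : ℂ)⁻¹ * (q * conj q) - 1 / 2 = -((s : ℂ)⁻¹ * (p * conj p)) / 2 := by
      field_simp
      simp only [Complex.mul_conj, hs]
      push_cast
      ring
    rw [this, norm_div, norm_neg, norm_mul, norm_mul, norm_inv, RCLike.norm_conj,
      Complex.norm_real, Real.norm_of_nonneg hspos.le, Complex.norm_ofNat]
    have : 0 ≤ s⁻¹ * (‖p‖ * ‖p‖) := by positivity
    linarith
  have hqp : s⁻¹ * (‖q‖ * ‖p‖) ≤ ‖p‖ / ‖q‖ := by rwa [mul_comm ‖q‖]
  have habs : |s|⁻¹ = s⁻¹ := by rw [abs_of_pos hspos]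
  rw [Matrix.sub_apply, Matrix.smul_apply, Matrix.vecMulVec_apply, smul_eq_mul]
  fin_cases i <;> fin_cases j <;>
    first
    | exact hqq
    | simpa [habs] using hpp
    | simpa [habs] using hpq
    | simpa [habs] using hqp

theorem stmt10 (t : ℝ) (lam₁ : ℂ) (him : 0 < lam₁.im) (c₁ : ℂ) (hc₁ : c₁ ≠ 0) (lam : ℂ)
    (h : lam ≠ conj lam₁) :
    let r : ℂ := (lam - lam₁) / (lam - conj lam₁)
    let Φ : ℝ → Fin 3 → ℂ := fun x =>
      ![Complex.exp (-Complex.I * lam₁ * ((x : ℂ) + lam₁ * (t : ℂ))),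
        c₁ * Complex.exp (Complex.I * lam₁ * ((x : ℂ) + lam₁ * (t : ℂ))),
        c₁ * Complex.exp (Complex.I * lam₁ * ((x : ℂ) + lam₁ * (t : ℂ)))]
    let S : ℝ → ℂ := fun x =>
      ((Complex.normSq (Φ x 0) + Complex.normSq (Φ x 1) + Complex.normSq (Φ x 2) : ℝ) : ℂ)
    let T : ℝ → Matrix (Fin 3) (Fin 3) ℂ := fun x =>
      1 - ((lam₁ - conj lam₁) / ((lam - conj lam₁) * S x)) •
        Matrix.vecMulVec (Φ x) (fun i => conj (Φ x i))
    let A : Matrix (Fin 3) (Fin 3) ℂ :=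
      !![1, 0, 0;
         0, 1 / 2 + r / 2, -(1 / 2) + r / 2;
         0, -(1 / 2) + r / 2, 1 / 2 + r / 2]
    ∀ i j : Fin 3,
      (fun x : ℝ => (T x - A) i j) =O[Filter.atBot] fun x : ℝ => Real.exp (2 * lam₁.im * x) := by
  intro r Φ S T A i j
  have hd : lam - conj lam₁ ≠ 0 := sub_ne_zero.mpr h
  set κ : ℂ := (lam₁ - conj lam₁) / (lam - conj lam₁) with hκ
  have hr : r = 1 - κ := by
    simp only [r, hκ]
    field_simp
    ring
  have hTA (x : ℝ) : T x - A = -κ • ((S x)⁻¹ •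
      Matrix.vecMulVec (Φ x) (fun i => conj (Φ x i)) -
        !![0, 0, 0; 0, 1 / 2, 1 / 2; 0, 1 / 2, 1 / 2]) := by
    have hA : A = 1 - κ • !![0, 0, 0; 0, 1 / 2, 1 / 2; 0, 1 / 2, 1 / 2] := by
      simp only [A, hr]
      ext i j
      fin_cases i <;> fin_cases j <;> simp <;> ring
    simp only [T]
    rw [hA, ← div_div, ← hκ, div_eq_mul_inv κ, mul_smul, smul_sub, neg_smul, neg_smul]
    abel
  have hratio (x : ℝ) : ‖Φ x 0‖ / ‖Φ x 1‖ =
      Real.exp (2 * (lam₁ ^ 2).im * t) / ‖c₁‖ * Real.exp (2 * lam₁.im * x) := by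
    have hc : ‖c₁‖ ≠ 0 := norm_ne_zero_iff.mpr hc₁
    simp only [Φ, Matrix.cons_val_zero, Matrix.cons_val_one, norm_mul, Complex.norm_exp]
    rw [div_mul_eq_mul_div, ← Real.exp_add, mul_comm ‖c₁‖, ← div_div, ← Real.exp_sub]
    congr 2
    simp [pow_two]
    ring
  refine IsBigO.of_bound (‖κ‖ * (Real.exp (2 * (lam₁ ^ 2).im * t) / ‖c₁‖))
    (Filter.Eventually.of_forall fun x => ?_)
  rw [hTA, Matrix.smul_apply, norm_smul, norm_neg, Real.norm_of_nonneg (Real.exp_nonneg _),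
    mul_assoc, ← hratio]
  gcongr
  exact norm_projection_sub_le _ _ (mul_ne_zero hc₁ (Complex.exp_ne_zero _)) i j
end

section
/- Let a, b, α, β, γ ∈ ℝ with b > 0, and define q₁(x,t) = 2 b cos(α) i sech(2b(x+2at)) exp(2i((b²−a²)t − a x − β)) and q₂(x,t) = 2 b sin(α) i sech(2b(x+2at)) exp(2i((b²−a²)t − a x − γ)), where sech(y) = 1/cosh(y). Then for every t ∈ ℝ, −(i/2) ∫_ℝ (q₁ conj(∂_x q₁) + q₂ conj(∂_x q₂) − conj(q₁) ∂_x q₁ − conj(q₂) ∂_x q₂) dx = 8ab, where ∂_x denotes the partial derivative in the spatial variable x. -/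
open ComplexConjugate

/-- The single bright soliton profile of the coupled NLS equation, with spectral
parameters `a`, `b` (so `λ₁ = a + i b`), amplitude factor `A` and phase `ph`. -/
noncomputable def soliton (a b A ph : ℝ) (x t : ℝ) : ℂ :=
  2 * (b : ℂ) * (A : ℂ) * Complex.I * ((1 / Real.cosh (2 * b * (x + 2 * a * t)) : ℝ) : ℂ) *
    Complex.exp (2 * Complex.I * (((b ^ 2 - a ^ 2) * t - a * x - ph : ℝ) : ℂ))

theorem integrable_inv_cosh_sq : MeasureTheory.Integrable fun x : ℝ => (Real.cosh x ^ 2)⁻¹ := by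
  refine integrable_inv_one_add_sq.mono' ?_ (Filter.Eventually.of_forall fun x => ?_)
  · exact (Continuous.inv₀ (by fun_prop) fun x => by
      have := Real.cosh_pos x; positivity).aestronglyMeasurable
  · have h : x ^ 2 ≤ Real.sinh x ^ 2 := by
      rw [sq_le_sq, Real.abs_sinh]
      exact Real.self_le_sinh_iff.2 (abs_nonneg x)
    rw [Real.norm_of_nonneg (by positivity), Real.cosh_sq']
    gcongr

theorem tendsto_tanh_atTop : Filter.Tendsto Real.tanh Filter.atTop (nhds 1) := by
  have h : Real.tanh = fun x => 1 - 2 / (Real.exp (2 * x) + 1) := by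
    funext x
    have := Real.exp_pos x
    rw [Real.tanh_eq_sinh_div_cosh, Real.sinh_eq, Real.cosh_eq, Real.exp_neg, two_mul,
      Real.exp_add]
    field_simp
    ring
  have hlim : Filter.Tendsto (fun x : ℝ => Real.exp (2 * x) + 1) Filter.atTop Filter.atTop :=
    Filter.tendsto_atTop_add_const_right _ _
      (Real.tendsto_exp_atTop.comp (Filter.tendsto_id.const_mul_atTop two_pos))
  rw [h]
  simpa using (hlim.const_div_atTop 2).const_sub 1

theorem tendsto_tanh_atBot : Filter.Tendsto Real.tanh Filter.atBot (nhds (-1)) := by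
  have h := (tendsto_tanh_atTop.comp Filter.tendsto_neg_atBot_atTop).neg
  refine h.congr fun x => ?_
  simp

theorem integral_inv_cosh_sq : ∫ x : ℝ, (Real.cosh x ^ 2)⁻¹ = 2 := by
  have hderiv (x : ℝ) : HasDerivAt Real.tanh (Real.cosh x ^ 2)⁻¹ x := by
    have hc := (Real.cosh_pos x).ne'
    have h := (Real.hasDerivAt_sinh x).div (Real.hasDerivAt_cosh x) hc
    have hfun : Real.tanh = Real.sinh / Real.cosh := funext Real.tanh_eq_sinh_div_cosh
    rw [hfun]
    refine h.congr_deriv ?_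
    rw [← sq, ← sq, Real.cosh_sq x, add_sub_cancel_left, one_div]
  rw [MeasureTheory.integral_of_hasDerivAt_of_tendsto hderiv integrable_inv_cosh_sq
    tendsto_tanh_atBot tendsto_tanh_atTop]
  norm_num

/-- The momentum density of a function with polar form `C * r * exp (2 i θ)`. -/
theorem mul_conj_deriv_sub_polar {r θ : ℝ → ℝ} {r' θ' x : ℝ} (C : ℂ)
    (hr : HasDerivAt r r' x) (hθ : HasDerivAt θ θ' x) :
    let q : ℝ → ℂ := fun y => C * (r y : ℂ) * Complex.exp (2 * Complex.I * (θ y : ℂ))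
    q x * conj (deriv q x) - conj (q x) * deriv q x
      = -4 * Complex.I * θ' * (C * conj C) * (r x : ℂ) ^ 2 := by
  intro q
  have hq : HasDerivAt q _ x :=
    (hr.ofReal_comp.const_mul C).mul (hθ.ofReal_comp.const_mul (2 * Complex.I)).cexp
  have hexp : Complex.exp (2 * Complex.I * (θ x : ℂ)) * Complex.exp (-(2 * Complex.I * (θ x : ℂ)))
      = 1 := by
    rw [← Complex.exp_add, add_neg_cancel, Complex.exp_zero]
  rw [hq.deriv]
  simp only [q, map_mul, map_add, ← Complex.exp_conj, Complex.conj_I, Complex.conj_ofReal,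
    map_ofNat, mul_neg, neg_mul]
  linear_combination (-4 * Complex.I * θ' * (C * conj C) * (r x : ℂ) ^ 2) * hexp

theorem soliton_momentum_density (a b A ph x t : ℝ) :
    soliton a b A ph x t * conj (deriv (fun y => soliton a b A ph y t) x)
      - conj (soliton a b A ph x t) * deriv (fun y => soliton a b A ph y t) x
      = ((16 * a * b ^ 2 * A ^ 2 * (Real.cosh (2 * b * (x + 2 * a * t)) ^ 2)⁻¹ : ℝ) : ℂ) * Complex.I := by
  have hθ : HasDerivAt (fun y : ℝ => (b ^ 2 - a ^ 2) * t - a * y - ph) (-a) x := by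
    simpa using (((hasDerivAt_id x).const_mul a).const_sub ((b ^ 2 - a ^ 2) * t)).sub_const ph
  have hr : DifferentiableAt ℝ (fun y : ℝ => 1 / Real.cosh (2 * b * (y + 2 * a * t))) x :=
    (differentiableAt_const 1).div (by fun_prop) (Real.cosh_pos _).ne'
  have h := mul_conj_deriv_sub_polar (2 * (b : ℂ) * (A : ℂ) * Complex.I) hr.hasDerivAt hθ
  refine h.trans ?_
  simp only [map_mul, Complex.conj_I, Complex.conj_ofReal, map_ofNat]
  push_cast
  simp only [one_div, inv_pow]
  linear_combination (-16 * Complex.I * a * b ^ 2 * A ^ 2 *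
    (Complex.cosh (2 * b * (x + 2 * a * t)) ^ 2)⁻¹) * Complex.I_sq

theorem stmt13 (a b α β γ : ℝ) (hb : 0 < b) (t : ℝ) :
    -(Complex.I / 2) *
        ∫ x : ℝ,
          (soliton a b (Real.cos α) β x t * conj (deriv (fun y => soliton a b (Real.cos α) β y t) x)
            + soliton a b (Real.sin α) γ x t * conj (deriv (fun y => soliton a b (Real.sin α) γ y t) x)
            - conj (soliton a b (Real.cos α) β x t) * deriv (fun y => soliton a b (Real.cos α) β y t) x
            - conj (soliton a b (Real.sin α) γ x t) * deriv (fun y => soliton a b (Real.sin α) γ y t) x)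
      = ((8 * a * b : ℝ) : ℂ) := by
  have hdens (x : ℝ) :
      soliton a b (Real.cos α) β x t * conj (deriv (fun y => soliton a b (Real.cos α) β y t) x)
        + soliton a b (Real.sin α) γ x t * conj (deriv (fun y => soliton a b (Real.sin α) γ y t) x)
        - conj (soliton a b (Real.cos α) β x t) * deriv (fun y => soliton a b (Real.cos α) β y t) x
        - conj (soliton a b (Real.sin α) γ x t) * deriv (fun y => soliton a b (Real.sin α) γ y t) x
      = ((16 * a * b ^ 2 * (Real.cosh (2 * b * (x + 2 * a * t)) ^ 2)⁻¹ : ℝ) : ℂ)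
        * Complex.I := by
    have h₁ := soliton_momentum_density a b (Real.cos α) β x t
    have h₂ := soliton_momentum_density a b (Real.sin α) γ x t
    have htrig : (Real.sin α : ℂ) ^ 2 + (Real.cos α : ℂ) ^ 2 = 1 := by
      exact_mod_cast Real.sin_sq_add_cos_sq α
    rw [Complex.ofReal_mul, Complex.ofReal_mul _ (Real.cos α ^ 2), Complex.ofReal_pow] at h₁
    rw [Complex.ofReal_mul, Complex.ofReal_mul _ (Real.sin α ^ 2), Complex.ofReal_pow] at h₂
    rw [Complex.ofReal_mul]
    linear_combination h₁ + h₂ + ((16 * a * b ^ 2 : ℝ) : ℂ) *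
      (((Real.cosh (2 * b * (x + 2 * a * t)) ^ 2)⁻¹ : ℝ) : ℂ) * Complex.I * htrig
  have hint : ∫ x : ℝ, (Real.cosh (2 * b * (x + 2 * a * t)) ^ 2)⁻¹ = b⁻¹ := by
    rw [MeasureTheory.integral_add_right_eq_self
        (fun x : ℝ => (Real.cosh (2 * b * x) ^ 2)⁻¹) (2 * a * t),
      MeasureTheory.Measure.integral_comp_mul_left (fun x : ℝ => (Real.cosh x ^ 2)⁻¹) (2 * b),
      integral_inv_cosh_sq, abs_of_pos (by positivity), smul_eq_mul]
    field_simp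
  simp only [hdens]
  rw [MeasureTheory.integral_mul_const, integral_complex_ofReal, MeasureTheory.integral_const_mul,
    hint]
  have hval : 16 * a * b ^ 2 * b⁻¹ = 16 * a * b := by field_simp
  rw [hval]
  push_cast
  linear_combination (-8 * a * b : ℂ) * Complex.I_sq
end

section
/- Let v ∈ ℝ with v ≠ 0, and consider the cubic equation 2 v z³ + z² − 1 = 0 in the real variable z. If |v| < √3/9 then this equation has three distinct real roots. If |v| > √3/9 then this equation has exactly one real root. -/
theorem exists_root_cubic_Ioo {v a b : ℝ} (hab : a ≤ b)
    (h : (2 * v * a ^ 3 + a ^ 2 - 1) * (2 * v * b ^ 3 + b ^ 2 - 1) < 0) :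
    ∃ z, a < z ∧ z < b ∧ 2 * v * z ^ 3 + z ^ 2 - 1 = 0 := by
  have hc : ContinuousOn (fun z : ℝ => 2 * v * z ^ 3 + z ^ 2 - 1) (Set.Icc a b) := by fun_prop
  rcases mul_neg_iff.mp h with ⟨ha, hb⟩ | ⟨ha, hb⟩
  · obtain ⟨z, hz, h0⟩ := intermediate_value_Ioo' hab hc ⟨hb, ha⟩
    exact ⟨z, hz.1, hz.2, h0⟩
  · obtain ⟨z, hz, h0⟩ := intermediate_value_Ioo hab hc ⟨ha, hb⟩
    exact ⟨z, hz.1, hz.2, h0⟩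

theorem exists_pos_root_cubic {v : ℝ} (hv : 0 < v) :
    ∃ z, 0 < z ∧ z < 1 ∧ 2 * v * z ^ 3 + z ^ 2 - 1 = 0 :=
  exists_root_cubic_Ioo zero_le_one (by norm_num; exact hv)

theorem exists_three_roots_cubic {v : ℝ} (hv : 0 < v) (h : v < √3 / 9) :
    ∃ z₁ z₂ z₃ : ℝ, z₁ < z₂ ∧ z₂ < z₃ ∧
      2 * v * z₁ ^ 3 + z₁ ^ 2 - 1 = 0 ∧
      2 * v * z₂ ^ 3 + z₂ ^ 2 - 1 = 0 ∧
      2 * v * z₃ ^ 3 + z₃ ^ 2 - 1 = 0 := by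
  have hs : √3 ^ 2 = 3 := Real.sq_sqrt (by norm_num)
  have hs0 : 0 < √3 := by positivity
  have hmid : 0 < 2 * v * (-√3) ^ 3 + (-√3) ^ 2 - 1 := by
    have : 2 * v * (-√3) ^ 3 + (-√3) ^ 2 - 1 = 2 - 6 * (v * √3) := by
      linear_combination (-2 * v * √3 + 1) * hs
    nlinarith
  have hleft : 2 * v * (-v⁻¹) ^ 3 + (-v⁻¹) ^ 2 - 1 < 0 := by
    have : 2 * v * (-v⁻¹) ^ 3 + (-v⁻¹) ^ 2 - 1 = -(v⁻¹ ^ 2) - 1 := by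
      field_simp
      ring
    rw [this]
    nlinarith [sq_nonneg v⁻¹]
  have hle : -v⁻¹ ≤ -√3 := by
    rw [neg_le_neg_iff, le_inv_comm₀ hs0 hv, ← one_div, le_div_iff₀ hs0]
    nlinarith
  obtain ⟨z₁, -, h₁, e₁⟩ := exists_root_cubic_Ioo hle (mul_neg_of_neg_of_pos hleft hmid)
  obtain ⟨z₂, h₂, h₂', e₂⟩ := exists_root_cubic_Ioo (v := v) (neg_nonpos.mpr hs0.le)
    (mul_neg_of_pos_of_neg hmid (by norm_num))
  obtain ⟨z₃, h₃, -, e₃⟩ := exists_pos_root_cubic hv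
  exact ⟨z₁, z₂, z₃, h₁.trans h₂, h₂'.trans h₃, e₁, e₂, e₃⟩

theorem pos_of_root_cubic {v z : ℝ} (h : √3 / 9 < v)
    (hz : 2 * v * z ^ 3 + z ^ 2 - 1 = 0) : 0 < z := by
  by_contra! hneg
  have hs : √3 ^ 2 = 3 := Real.sq_sqrt (by norm_num)
  have hne : z ≠ 0 := by
    rintro rfl
    norm_num at hz
  have hy : 0 < -z := neg_pos.mpr (lt_of_le_of_ne hneg hne)
  have hfac : 0 ≤ (-z - √3) ^ 2 * (2 * √3 / 9 * -z + 1 / 3) := by positivity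
  have hpos : 0 < (v - √3 / 9) * (-z) ^ 3 := mul_pos (sub_pos.mpr h) (by positivity)
  have key : (-z - √3) ^ 2 * (2 * √3 / 9 * -z + 1 / 3) =
      2 * √3 / 9 * (-z) ^ 3 - z ^ 2 + 1 := by
    linear_combination (-(4 / 9) * z ^ 2 - 2 * √3 / 9 * z + 1 / 3) * hs
  linarith

theorem existsUnique_root_cubic {v : ℝ} (h : √3 / 9 < v) :
    ∃! z : ℝ, 2 * v * z ^ 3 + z ^ 2 - 1 = 0 := by
  have hv : 0 < v := lt_trans (by positivity) h
  obtain ⟨z, hz, -, e⟩ := exists_pos_root_cubic hv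
  refine ⟨z, e, fun y ey => ?_⟩
  have hy := pos_of_root_cubic h ey
  have hfac : (y - z) * (2 * v * (y ^ 2 + y * z + z ^ 2) + (y + z)) = 0 := by
    linear_combination ey - e
  have hne : 2 * v * (y ^ 2 + y * z + z ^ 2) + (y + z) ≠ 0 := by positivity
  exact sub_eq_zero.mp ((mul_eq_zero.mp hfac).resolve_right hne)

theorem stmt15 (v : ℝ) (hv : v ≠ 0) :
    (|v| < Real.sqrt 3 / 9 →
      ∃ z₁ z₂ z₃ : ℝ, z₁ < z₂ ∧ z₂ < z₃ ∧
        2 * v * z₁ ^ 3 + z₁ ^ 2 - 1 = 0 ∧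
        2 * v * z₂ ^ 3 + z₂ ^ 2 - 1 = 0 ∧
        2 * v * z₃ ^ 3 + z₃ ^ 2 - 1 = 0) ∧
    (Real.sqrt 3 / 9 < |v| →
      ∃! z : ℝ, 2 * v * z ^ 3 + z ^ 2 - 1 = 0) := by
  rcases hv.lt_or_gt with hneg | hpos
  · rw [abs_of_neg hneg]
    constructor
    · intro h
      obtain ⟨z₁, z₂, z₃, h₁, h₂, e₁, e₂, e₃⟩ := exists_three_roots_cubic (neg_pos.mpr hneg) h
      exact ⟨-z₃, -z₂, -z₁, neg_lt_neg h₂, neg_lt_neg h₁, by linear_combination e₃,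
        by linear_combination e₂, by linear_combination e₁⟩
    · intro h
      obtain ⟨z, e, hu⟩ := existsUnique_root_cubic h
      refine ⟨-z, by linear_combination e, fun y ey => ?_⟩
      exact neg_eq_iff_eq_neg.mp (hu (-y) (by linear_combination ey))
  · rw [abs_of_pos hpos]
    exact ⟨exists_three_roots_cubic hpos, existsUnique_root_cubic⟩
end

section
/- Let v ∈ ℝ with 0 < v < √3/9, and let z₁ < z₂ < z₃ be real numbers each satisfying 2 v z³ + z² − 1 = 0. Then z₁ < z₂ < 0 < z₃, and moreover 2v + 2/z₂³ < 0 and 2v + 2/z₃³ > 0; that is, writing θ̃(z; v) = z + v z² + z⁻¹ and a(v) = z₂, b(v) = z₃, one has θ̃''(a(v); v) < 0 and θ̃''(b(v); v) > 0. -/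
/-- At a root `x ≠ 0` of `2 v z³ + z² - 1` whose two other roots are `y` and `w`, the second
derivative of `z + v z² + z⁻¹` is expressed by the differences of the roots. -/
theorem second_deriv_eq_of_roots {v x y w : ℝ} (hx : x ≠ 0)
    (hsum : 2 * v * (x + y + w) + 1 = 0) (hpair : x * y + x * w + y * w = 0)
    (e : 2 * v * x ^ 3 + x ^ 2 - 1 = 0) :
    2 * v + 2 / x ^ 3 = 2 * v * ((x - y) * (x - w)) / x ^ 2 := by
  field_simp
  linear_combination x ^ 2 * hsum - v * x * hpair - e

theorem stmt16 (v : ℝ) (hv₀ : 0 < v) (hv : v < Real.sqrt 3 / 9)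
    (z₁ z₂ z₃ : ℝ) (h₁₂ : z₁ < z₂) (h₂₃ : z₂ < z₃)
    (e₁ : 2 * v * z₁ ^ 3 + z₁ ^ 2 - 1 = 0)
    (e₂ : 2 * v * z₂ ^ 3 + z₂ ^ 2 - 1 = 0)
    (e₃ : 2 * v * z₃ ^ 3 + z₃ ^ 2 - 1 = 0) :
    z₂ < 0 ∧ 0 < z₃ ∧ 2 * v + 2 / z₂ ^ 3 < 0 ∧ 0 < 2 * v + 2 / z₃ ^ 3 := by
  have q₁₂ : 2 * v * (z₁ ^ 2 + z₁ * z₂ + z₂ ^ 2) + (z₁ + z₂) = 0 :=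
    mul_left_cancel₀ (sub_pos.2 h₁₂).ne' (by linear_combination e₂ - e₁)
  have q₂₃ : 2 * v * (z₂ ^ 2 + z₂ * z₃ + z₃ ^ 2) + (z₂ + z₃) = 0 :=
    mul_left_cancel₀ (sub_pos.2 h₂₃).ne' (by linear_combination e₃ - e₂)
  have hsum : 2 * v * (z₁ + z₂ + z₃) + 1 = 0 :=
    mul_left_cancel₀ (sub_pos.2 (h₁₂.trans h₂₃)).ne' (by linear_combination q₂₃ - q₁₂)
  have hpair : z₁ * z₂ + z₁ * z₃ + z₂ * z₃ = 0 :=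
    mul_left_cancel₀ (mul_pos two_pos hv₀).ne'
      (by linear_combination (z₁ + z₂) * hsum - q₁₂)
  have hprod : 2 * v * (z₁ * z₂ * z₃) = 1 := by
    linear_combination e₁ - z₁ ^ 2 * hsum + 2 * v * z₁ * hpair
  have hpos : 0 < z₁ * z₂ * z₃ :=
    pos_of_mul_pos_right (hprod ▸ one_pos) (mul_pos two_pos hv₀).le
  have h₃ : 0 < z₃ := by
    by_contra! h
    have := mul_pos_of_neg_of_neg (h₁₂.trans (h₂₃.trans_le h)) (h₂₃.trans_le h)
    nlinarith
  have h₂ : z₂ < 0 := by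
    by_contra! h
    have h12 : 0 < z₁ * z₂ := pos_of_mul_pos_left hpos h₃.le
    have h1 : 0 < z₁ := pos_of_mul_pos_left h12 h
    nlinarith [mul_pos h1 h₃, mul_nonneg h h₃.le]
  refine ⟨h₂, h₃, ?_, ?_⟩
  · rw [second_deriv_eq_of_roots h₂.ne (y := z₁) (w := z₃) (by linarith) (by linarith) e₂]
    exact div_neg_of_neg_of_pos (mul_neg_of_pos_of_neg (by positivity)
      (mul_neg_of_pos_of_neg (sub_pos.2 h₁₂) (sub_neg.2 h₂₃))) (sq_pos_of_neg h₂)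
  · rw [second_deriv_eq_of_roots h₃.ne' (y := z₁) (w := z₂) (by linarith) (by linarith) e₃]
    exact div_pos (mul_pos (by positivity)
      (mul_pos (sub_pos.2 (h₁₂.trans h₂₃)) (sub_pos.2 h₂₃))) (by positivity)
end

section
/- Let A : ℝ → ℝ and B, Q : ℝ → ℂ be functions that are differentiable at every x > 0 and satisfy, for all x > 0: Q'(x) = −x B(x), x A'(x) = 2(Q(x) conj(B(x)) + conj(Q(x)) B(x)) (whose right-hand side is real), and x B'(x) = −4 A(x) Q(x). Then the functions x ↦ A(x)² + |B(x)|² and x ↦ B(x) conj(Q(x)) − conj(B(x)) Q(x) are constant on (0, ∞). -/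
open ComplexConjugate

theorem eq_of_hasDerivAt_zero_of_pos {f : ℝ → ℂ}
    (hf : ∀ x > (0 : ℝ), HasDerivAt f 0 x) :
    ∀ x > (0 : ℝ), ∀ y > (0 : ℝ), f x = f y := fun _ hx _ hy =>
  isOpen_Ioi.is_const_of_deriv_eq_zero (convex_Ioi (0 : ℝ)).isPreconnected
    (fun z hz => (hf z hz).differentiableAt.differentiableWithinAt)
    (fun z hz => (hf z hz).deriv) hx hy

theorem stmt18 (A : ℝ → ℝ) (B Q : ℝ → ℂ)
    (hA : ∀ x > (0 : ℝ), DifferentiableAt ℝ A x)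
    (hB : ∀ x > (0 : ℝ), DifferentiableAt ℝ B x)
    (hQ : ∀ x > (0 : ℝ), DifferentiableAt ℝ Q x)
    (h1 : ∀ x > (0 : ℝ), deriv Q x = -(x : ℂ) * B x)
    (h2 : ∀ x > (0 : ℝ),
      (x : ℂ) * ((deriv A x : ℝ) : ℂ) = 2 * (Q x * conj (B x) + conj (Q x) * B x))
    (h3 : ∀ x > (0 : ℝ), (x : ℂ) * deriv B x = -4 * (A x : ℂ) * Q x) :
    (∀ x > (0 : ℝ), ∀ y > (0 : ℝ),
      A x ^ 2 + Complex.normSq (B x) = A y ^ 2 + Complex.normSq (B y)) ∧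
    (∀ x > (0 : ℝ), ∀ y > (0 : ℝ),
      B x * conj (Q x) - conj (B x) * Q x = B y * conj (Q y) - conj (B y) * Q y) := by
  have hx0 : ∀ x > (0 : ℝ), (x : ℂ) ≠ 0 := fun x hx => by exact_mod_cast hx.ne'
  have hBc : ∀ x > (0 : ℝ),
      HasDerivAt (fun t => conj (B t)) (conj (deriv B x)) x :=
    fun x hx => (hB x hx).hasDerivAt.star
  have hQc : ∀ x > (0 : ℝ),
      HasDerivAt (fun t => conj (Q t)) (conj (deriv Q x)) x :=
    fun x hx => (hQ x hx).hasDerivAt.star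
  have h1c : ∀ x > (0 : ℝ), conj (deriv Q x) = -(x : ℂ) * conj (B x) := fun x hx => by
    simp [h1 x hx]
  have h3c : ∀ x > (0 : ℝ), (x : ℂ) * conj (deriv B x) = -4 * (A x : ℂ) * conj (Q x) :=
    fun x hx => by simpa [Complex.conj_ofNat] using congrArg conj (h3 x hx)
  constructor
  · intro x hx y hy
    have key := eq_of_hasDerivAt_zero_of_pos
      (f := fun t => (A t : ℂ) * (A t : ℂ) + B t * conj (B t)) (fun z hz => by
        have hAz := (hA z hz).hasDerivAt.ofReal_comp
        refine ((hAz.mul hAz).add ((hB z hz).hasDerivAt.mul (hBc z hz))).congr_deriv ?_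
        refine (mul_eq_zero.mp ?_).resolve_left (hx0 z hz)
        linear_combination 2 * (A z : ℂ) * h2 z hz + conj (B z) * h3 z hz + B z * h3c z hz)
      x hx y hy
    simp only [Complex.mul_conj] at key
    have key' : A x * A x + Complex.normSq (B x) = A y * A y + Complex.normSq (B y) := by
      exact_mod_cast key
    simpa only [sq] using key'
  · refine eq_of_hasDerivAt_zero_of_pos
      (f := fun t => B t * conj (Q t) - conj (B t) * Q t) fun z hz => ?_
    refine (((hB z hz).hasDerivAt.mul (hQc z hz)).sub
      ((hBc z hz).mul (hQ z hz).hasDerivAt)).congr_deriv ?_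
    rw [h1c z hz, h1 z hz]
    refine (mul_eq_zero.mp ?_).resolve_left (hx0 z hz)
    linear_combination conj (Q z) * h3 z hz - Q z * h3c z hz
end

section
/- Let A : ℝ → ℝ and B, Q : ℝ → ℂ be functions differentiable at every x > 0 satisfying, for all x > 0: Q'(x) = −x B(x), x A'(x) = 2(Q(x) conj(B(x)) + conj(Q(x)) B(x)), x B'(x) = −4 A(x) Q(x), together with A(x)² + |B(x)|² = 2, and suppose B(x) ≠ 0 and Q(x) ≠ 0 for all x > 0. Let C₂ ∈ ℂ be the constant value of B(x) conj(Q(x)) − conj(B(x)) Q(x), and define y(x) = Q(x)/(x B(x)). Then y is twice differentiable on (0, ∞) and satisfies the Painlevé-III equation y''(x) = y'(x)²/y(x) − y'(x)/x + (8 C₂ y(x)² − 2)/x + 32 y(x)³ − 1/y(x) for all x > 0; in particular y'(x) = −1 − y(x)/x + 4 A(x) y(x)² for all x > 0. -/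
open ComplexConjugate

theorem stmt19 (A : ℝ → ℝ) (B Q : ℝ → ℂ)
    (hA : ∀ x > (0 : ℝ), DifferentiableAt ℝ A x)
    (hB : ∀ x > (0 : ℝ), DifferentiableAt ℝ B x)
    (hQ : ∀ x > (0 : ℝ), DifferentiableAt ℝ Q x)
    (h1 : ∀ x > (0 : ℝ), deriv Q x = -(x : ℂ) * B x)
    (h2 : ∀ x > (0 : ℝ),
      (x : ℂ) * ((deriv A x : ℝ) : ℂ) = 2 * (Q x * conj (B x) + conj (Q x) * B x))
    (h3 : ∀ x > (0 : ℝ), (x : ℂ) * deriv B x = -4 * (A x : ℂ) * Q x)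
    (hconstraint : ∀ x > (0 : ℝ), (A x : ℝ) ^ 2 + Complex.normSq (B x) = 2)
    (hBne : ∀ x > (0 : ℝ), B x ≠ 0) (hQne : ∀ x > (0 : ℝ), Q x ≠ 0)
    (C₂ : ℂ) (hC₂ : ∀ x > (0 : ℝ), B x * conj (Q x) - conj (B x) * Q x = C₂) :
    let y : ℝ → ℂ := fun x => Q x / ((x : ℂ) * B x)
    (∀ x > (0 : ℝ), DifferentiableAt ℝ y x) ∧
    (∀ x > (0 : ℝ), DifferentiableAt ℝ (deriv y) x) ∧
    (∀ x > (0 : ℝ),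
      deriv (deriv y) x =
        (deriv y x) ^ 2 / y x - deriv y x / (x : ℂ) +
          (8 * C₂ * (y x) ^ 2 - 2) / (x : ℂ) + 32 * (y x) ^ 3 - 1 / y x) ∧
    (∀ x > (0 : ℝ), deriv y x = -1 - y x / (x : ℂ) + 4 * (A x : ℂ) * (y x) ^ 2) := by
  intro y
  have hy : ∀ x > (0 : ℝ),
      HasDerivAt y (-1 - y x / (x : ℂ) + 4 * (A x : ℂ) * (y x) ^ 2) x := by
    intro x hx
    have hx0 : (x : ℂ) ≠ 0 := Complex.ofReal_ne_zero.mpr hx.ne'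
    have hB0 := hBne x hx
    have hB' : deriv B x = -4 * (A x : ℂ) * Q x / x := by
      rw [eq_div_iff hx0, ← h3 x hx, mul_comm]
    have hid : HasDerivAt (fun t : ℝ => (t : ℂ)) 1 x := Complex.ofRealCLM.hasDerivAt
    refine ((hQ x hx).hasDerivAt.div (hid.mul (hB x hx).hasDerivAt)
      (mul_ne_zero hx0 hB0)).congr_deriv ?_
    simp only [y, h1 x hx, hB', Pi.mul_apply]
    field_simp
    ring
  have hyy : ∀ x > (0 : ℝ), HasDerivAt (deriv y)
      (y x / (x : ℂ) ^ 2 - deriv y x / (x : ℂ) + 4 * ((deriv A x : ℝ) : ℂ) * (y x) ^ 2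
        + 8 * (A x : ℂ) * y x * deriv y x) x := by
    intro x hx
    have hx0 : (x : ℂ) ≠ 0 := Complex.ofReal_ne_zero.mpr hx.ne'
    have hid : HasDerivAt (fun t : ℝ => (t : ℂ)) 1 x := Complex.ofRealCLM.hasDerivAt
    have hd : HasDerivAt y (deriv y x) x := (hy x hx).differentiableAt.hasDerivAt
    have heq : deriv y =ᶠ[nhds x]
        fun t : ℝ => -1 - y t / (t : ℂ) + 4 * (A t : ℂ) * (y t) ^ 2 := by
      filter_upwards [lt_mem_nhds hx] with t ht using (hy t ht).deriv
    refine HasDerivAt.congr_of_eventuallyEq ?_ heq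
    refine (((hd.fun_div hid hx0).const_sub (-1)).fun_add
      (((hA x hx).hasDerivAt.ofReal_comp.const_mul 4).fun_mul (hd.fun_pow 2))).congr_deriv ?_
    field_simp
    push_cast
    ring
  refine ⟨fun x hx => (hy x hx).differentiableAt, fun x hx => (hyy x hx).differentiableAt,
    fun x hx => ?_, fun x hx => (hy x hx).deriv⟩
  have hx0 : (x : ℂ) ≠ 0 := Complex.ofReal_ne_zero.mpr hx.ne'
  have hy0 : y x ≠ 0 := div_ne_zero (hQne x hx) (mul_ne_zero hx0 (hBne x hx))
  have hQy : Q x = x * B x * y x :=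
    (mul_div_cancel₀ (Q x) (mul_ne_zero hx0 (hBne x hx))).symm
  clear_value y
  have hnorm : (A x : ℂ) ^ 2 + B x * conj (B x) = 2 := by
    rw [Complex.mul_conj]
    exact_mod_cast hconstraint x hx
  have hA' : ((deriv A x : ℝ) : ℂ) = 2 * C₂ / x + 4 * (2 - (A x : ℂ) ^ 2) * y x := by
    refine mul_left_cancel₀ hx0 ?_
    rw [h2 x hx, ← hC₂ x hx]
    field_simp
    linear_combination 4 * conj (B x) * hQy + 4 * x * y x * hnorm
  rw [(hyy x hx).deriv, hA', (hy x hx).deriv]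
  field_simp
  ring
end
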